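/- Agreement of Filament's small-step and big-step checked semantics: for any command c, environment σ₁, and accessed-memory set ρ₁, the iterated checked small-step semantics takes the configuration (σ₁, ρ₁, c) to a terminal configuration (σ₂, ρ₂, skip) if and only if the checked large-step semantics derives σ₁, ρ₁, c ⇓ σ₂, ρ₂. -/

import Mathlib

/-! # Filament core language (Dahlia) -/

/-- Binary operators. -/
inductive Bop where
  | add | mul | eq | lt

/-- Values: `v ::= n | true | false | v₁ bop v₂`. -/
inductive Val where
  | num  : ℕ → Val
  | bool : Bool → Val
  | bop  : Bop → Val → Val → Val

/-- Expressions: `e ::= v | bop e₁ e₂ | x | a[e]`.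
Variables and memory names are drawn from disjoint syntactic positions. -/
inductive Exp where
  | val  : Val → Exp
  | bop  : Bop → Exp → Exp → Exp
  | var  : ℕ → Exp
  | read : ℕ → Exp → Exp

/-- Commands, including ordered composition `c₁ --- c₂`, the intermediate
ordered form `c₁ ~ρ~ c₂`, and unordered composition `c₁ ; c₂`. -/
inductive Cmd where
  | exp      : Exp → Cmd
  | letv     : ℕ → Exp → Cmd
  | seq      : Cmd → Cmd → Cmd             -- ordered composition `c₁ --- c₂`
  | interseq : Cmd → Set ℕ → Cmd → Cmd     -- intermediate form `c₁ ~ρ~ c₂`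
  | par      : Cmd → Cmd → Cmd             -- unordered composition `c₁ ; c₂`
  | ite      : ℕ → Cmd → Cmd → Cmd
  | while    : ℕ → Cmd → Cmd
  | assign   : ℕ → Exp → Cmd
  | write    : ℕ → Exp → Exp → Cmd
  | skip     : Cmd

/-- Types: `τ ::= bit⟨n⟩ | float | bool | mem τ[n]`. -/
inductive Ty where
  | bit   : ℕ → Ty
  | float : Ty
  | bool  : Ty
  | mem   : Ty → ℕ → Ty
  deriving DecidableEq

/-- Variable typing context `Γ`. -/
abbrev VCtx := ℕ → Option Ty
/-- Affine memory context `Δ`. -/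
abbrev MCtx := ℕ → Option Ty

/-- Environment `σ`: maps variables to values and memory names to
finite maps from indices to values. -/
structure Env where
  vars : ℕ → Option Val
  mems : ℕ → Option (ℕ → Val)

/-- The empty environment `∅`. -/
def emptyEnv : Env := ⟨fun _ => none, fun _ => none⟩

/-- Update a variable binding in the environment. -/
def Env.updVar (σ : Env) (x : ℕ) (v : Val) : Env :=
  ⟨fun y => if y = x then some v else σ.vars y, σ.mems⟩

/-- Update one memory cell `a[n] := v` in the environment. -/
def Env.updMem (σ : Env) (a n : ℕ) (v : Val) : Env :=
  ⟨σ.vars, fun b =>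
    if b = a then
      match σ.mems a with
      | some M => some (fun m => if m = n then v else M m)
      | none => none
    else σ.mems b⟩

/-- Remove (consume) a memory from an affine context. -/
def MCtx.erase (Δ : MCtx) (a : ℕ) : MCtx := fun b => if b = a then none else Δ b

/-- Extend a variable context with a new binding. -/
def VCtx.extend (Γ : VCtx) (x : ℕ) (τ : Ty) : VCtx :=
  fun y => if y = x then some τ else Γ y

/-- Intersection of two affine contexts: the resources remaining in both. -/
def MCtx.inter (Δ₁ Δ₂ : MCtx) : MCtx :=
  fun a => if Δ₁ a = Δ₂ a then Δ₁ a else none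

-- `ρ̄ = { a ↦ mem τ[n] ∈ Δ* : a ∉ ρ }`: the memories of the initial affine
-- context `Δ*` not yet consumed in `ρ`.
open Classical in
noncomputable def MCtx.restrict (Δstar : MCtx) (ρ : Set ℕ) : MCtx :=
  fun a => if a ∈ ρ then none else Δstar a

/-- Typing of values. -/
inductive ValHasTy : Val → Ty → Prop where
  | num  : ∀ n m, ValHasTy (.num n) (.bit m)
  | bool : ∀ b, ValHasTy (.bool b) .bool
  | bop  : ∀ op v₁ v₂ τ, ValHasTy v₁ τ → ValHasTy v₂ τ →
      ValHasTy (.bop op v₁ v₂) τ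

/-- Expression typing judgment `Γ, Δ ⊢ e : τ ⊣ Δ'`.
Reading a memory `a` requires `a` to be defined in the affine context and
removes it (affine consumption). -/
inductive ECheck (Γ : VCtx) : MCtx → Exp → Ty → MCtx → Prop where
  | val : ∀ Δ v τ, ValHasTy v τ → ECheck Γ Δ (.val v) τ Δ
  | bop : ∀ Δ Δ₂ Δ₃ op e₁ e₂ τ,
      ECheck Γ Δ e₁ τ Δ₂ → ECheck Γ Δ₂ e₂ τ Δ₃ →
      ECheck Γ Δ (.bop op e₁ e₂) τ Δ₃
  | var : ∀ Δ x τ, Γ x = some τ → ECheck Γ Δ (.var x) τ Δ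
  | read : ∀ Δ Δ₂ a e τ n m,
      ECheck Γ Δ e (.bit m) Δ₂ → Δ₂ a = some (.mem τ n) →
      ECheck Γ Δ (.read a e) τ (Δ₂.erase a)

/-- Command typing judgment `Γ, Δ ⊢ c ⊣ Γ', Δ'`, parameterized by the initial
affine context `Δ*` of all memories available to the program.  Unordered
composition threads the affine context; ordered composition checks both
commands under the same affine context and intersects the results; the
intermediate form `c₁ ~ρ~ c₂` checks `c₂` under `ρ̄`. -/
inductive CCheck (Δstar : MCtx) : VCtx → MCtx → Cmd → VCtx → MCtx → Prop where
  | exp : ∀ Γ Δ Δ₂ e τ, ECheck Γ Δ e τ Δ₂ →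
      CCheck Δstar Γ Δ (.exp e) Γ Δ₂
  | letv : ∀ Γ Δ Δ₂ x e τ, ECheck Γ Δ e τ Δ₂ →
      CCheck Δstar Γ Δ (.letv x e) (Γ.extend x τ) Δ₂
  | seq : ∀ Γ Δ Γ₂ Δ₂ Γ₃ Δ₃ c₁ c₂,
      CCheck Δstar Γ Δ c₁ Γ₂ Δ₂ → CCheck Δstar Γ₂ Δ c₂ Γ₃ Δ₃ →
      CCheck Δstar Γ Δ (.seq c₁ c₂) Γ₃ (Δ₂.inter Δ₃)
  | interseq : ∀ Γ Δ Γ₂ Δ₂ Γ₃ Δ₃ c₁ c₂ ρ,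
      CCheck Δstar Γ Δ c₁ Γ₂ Δ₂ →
      CCheck Δstar Γ (MCtx.restrict Δstar ρ) c₂ Γ₃ Δ₃ →
      CCheck Δstar Γ Δ (.interseq c₁ ρ c₂) Γ (Δ₂.inter Δ₃)
  | par : ∀ Γ Δ Γ₂ Δ₂ Γ₃ Δ₃ c₁ c₂,
      CCheck Δstar Γ Δ c₁ Γ₂ Δ₂ → CCheck Δstar Γ₂ Δ₂ c₂ Γ₃ Δ₃ →
      CCheck Δstar Γ Δ (.par c₁ c₂) Γ₃ Δ₃
  | ite : ∀ Γ Δ Γ₂ Δ₂ Γ₃ Δ₃ x c₁ c₂, Γ x = some .bool →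
      CCheck Δstar Γ Δ c₁ Γ₂ Δ₂ → CCheck Δstar Γ Δ c₂ Γ₃ Δ₃ →
      CCheck Δstar Γ Δ (.ite x c₁ c₂) Γ (Δ₂.inter Δ₃)
  | whileC : ∀ Γ Δ Γ₂ Δ₂ x c, Γ x = some .bool →
      CCheck Δstar Γ Δ c Γ₂ Δ₂ →
      CCheck Δstar Γ Δ (.while x c) Γ Δ
  | assign : ∀ Γ Δ Δ₂ x e τ, Γ x = some τ → ECheck Γ Δ e τ Δ₂ →
      CCheck Δstar Γ Δ (.assign x e) Γ Δ₂
  | write : ∀ Γ Δ Δ₂ Δ₃ a e₁ e₂ τ n m,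
      ECheck Γ Δ e₁ (.bit m) Δ₂ → ECheck Γ Δ₂ e₂ τ Δ₃ →
      Δ₃ a = some (.mem τ n) →
      CCheck Δstar Γ Δ (.write a e₁ e₂) Γ (Δ₃.erase a)
  | skip : ∀ Γ Δ, CCheck Δstar Γ Δ .skip Γ Δ

/-- Checked small-step semantics for expressions: `σ, ρ, e → σ', ρ', e'`.
A read `a[n]` can step only if `a ∉ ρ`, and the step adds `a` to `ρ`. -/
inductive EStep : Env → Set ℕ → Exp → Env → Set ℕ → Exp → Prop where
  | bop1 : ∀ σ ρ σ' ρ' op e₁ e₁' e₂, EStep σ ρ e₁ σ' ρ' e₁' →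
      EStep σ ρ (.bop op e₁ e₂) σ' ρ' (.bop op e₁' e₂)
  | bop2 : ∀ σ ρ σ' ρ' op v₁ e₂ e₂', EStep σ ρ e₂ σ' ρ' e₂' →
      EStep σ ρ (.bop op (.val v₁) e₂) σ' ρ' (.bop op (.val v₁) e₂')
  | bop3 : ∀ σ ρ op v₁ v₂,
      EStep σ ρ (.bop op (.val v₁) (.val v₂)) σ ρ (.val (.bop op v₁ v₂))
  | var : ∀ σ ρ x v, σ.vars x = some v → EStep σ ρ (.var x) σ ρ (.val v)
  | read1 : ∀ σ ρ σ' ρ' a e e', EStep σ ρ e σ' ρ' e' →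
      EStep σ ρ (.read a e) σ' ρ' (.read a e')
  | read2 : ∀ σ ρ a n M, a ∉ ρ → σ.mems a = some M →
      EStep σ ρ (.read a (.val (.num n))) σ (ρ ∪ {a}) (.val (M n))

/-- Checked small-step semantics for commands: `σ, ρ, c → σ', ρ', c'`.
Ordered composition `c₁ --- c₂` steps to the intermediate form `c₁ ~ρ~ c₂`
recording the current `ρ`; the intermediate form evaluates `c₁` and then `c₂`
each starting from the recorded set, and `skip ~ρ₀~ skip` steps to `skip`
while unioning `ρ₀` into the accessed set.  A write can step only if the
memory is not already in `ρ`. -/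
inductive CStep : Env → Set ℕ → Cmd → Env → Set ℕ → Cmd → Prop where
  | exp1 : ∀ σ ρ σ' ρ' e e', EStep σ ρ e σ' ρ' e' →
      CStep σ ρ (.exp e) σ' ρ' (.exp e')
  | exp2 : ∀ σ ρ v, CStep σ ρ (.exp (.val v)) σ ρ .skip
  | let1 : ∀ σ ρ σ' ρ' x e e', EStep σ ρ e σ' ρ' e' →
      CStep σ ρ (.letv x e) σ' ρ' (.letv x e')
  | let2 : ∀ σ ρ x v, CStep σ ρ (.letv x (.val v)) (σ.updVar x v) ρ .skip
  | seq : ∀ σ ρ c₁ c₂, CStep σ ρ (.seq c₁ c₂) σ ρ (.interseq c₁ ρ c₂)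
  | interseq1 : ∀ σ ρ σ' ρ' ρ₀ c₁ c₁' c₂, CStep σ ρ c₁ σ' ρ' c₁' →
      CStep σ ρ (.interseq c₁ ρ₀ c₂) σ' ρ' (.interseq c₁' ρ₀ c₂)
  | interseq2 : ∀ σ ρ σ' ρ₀ ρ₀' c₂ c₂', CStep σ ρ₀ c₂ σ' ρ₀' c₂' →
      CStep σ ρ (.interseq .skip ρ₀ c₂) σ' ρ (.interseq .skip ρ₀' c₂')
  | interseq3 : ∀ σ ρ ρ₀,
      CStep σ ρ (.interseq .skip ρ₀ .skip) σ (ρ ∪ ρ₀) .skip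
  | par1 : ∀ σ ρ σ' ρ' c₁ c₁' c₂, CStep σ ρ c₁ σ' ρ' c₁' →
      CStep σ ρ (.par c₁ c₂) σ' ρ' (.par c₁' c₂)
  | par2 : ∀ σ ρ c₂, CStep σ ρ (.par .skip c₂) σ ρ c₂
  | iteT : ∀ σ ρ x c₁ c₂, σ.vars x = some (.bool true) →
      CStep σ ρ (.ite x c₁ c₂) σ ρ c₁
  | iteF : ∀ σ ρ x c₁ c₂, σ.vars x = some (.bool false) →
      CStep σ ρ (.ite x c₁ c₂) σ ρ c₂
  | whileStep : ∀ σ ρ x c,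
      CStep σ ρ (.while x c) σ ρ (.ite x (.seq c (.while x c)) .skip)
  | assign1 : ∀ σ ρ σ' ρ' x e e', EStep σ ρ e σ' ρ' e' →
      CStep σ ρ (.assign x e) σ' ρ' (.assign x e')
  | assign2 : ∀ σ ρ x v,
      CStep σ ρ (.assign x (.val v)) (σ.updVar x v) ρ .skip
  | write1 : ∀ σ ρ σ' ρ' a e₁ e₁' e₂, EStep σ ρ e₁ σ' ρ' e₁' →
      CStep σ ρ (.write a e₁ e₂) σ' ρ' (.write a e₁' e₂)
  | write2 : ∀ σ ρ σ' ρ' a n e₂ e₂', EStep σ ρ e₂ σ' ρ' e₂' →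
      CStep σ ρ (.write a (.val (.num n)) e₂) σ' ρ'
        (.write a (.val (.num n)) e₂')
  | write3 : ∀ σ ρ a n v M, a ∉ ρ → σ.mems a = some M →
      CStep σ ρ (.write a (.val (.num n)) (.val v)) (σ.updMem a n v)
        (ρ ∪ {a}) .skip

/-- Configurations of the small-step machine. -/
abbrev Config := Env × Set ℕ × Cmd

/-- The small-step relation on configurations. -/
def Step (K K' : Config) : Prop := CStep K.1 K.2.1 K.2.2 K'.1 K'.2.1 K'.2.2

/-- A command that is a value. -/
def Cmd.isValue (c : Cmd) : Prop := ∃ v, c = Cmd.exp (.val v)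

/-- Equivalence `Γ, Δ ∼ σ, ρ`: every variable bound in `Γ` is bound in `σ`
to a value of the right type, and no memory in `Δ` has been consumed in `ρ`. -/
def EquivCtx (Γ : VCtx) (Δ : MCtx) (σ : Env) (ρ : Set ℕ) : Prop :=
  (∀ x τ, Γ x = some τ → ∃ v, σ.vars x = some v ∧ ECheck Γ Δ (.val v) τ Δ) ∧
  (∀ a τ, Δ a = some τ → a ∉ ρ)

/-- `Γ, Δ` can be constructed from `σ, ρ`: every variable bound in `σ` is
bound in `Γ` to the type of its value, and no memory in `ρ` is defined
in `Δ`. -/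
def Constructed (Γ : VCtx) (Δ : MCtx) (σ : Env) (ρ : Set ℕ) : Prop :=
  (∀ x v, σ.vars x = some v → ∃ τ, Γ x = some τ ∧ ECheck Γ Δ (.val v) τ Δ) ∧
  (∀ a, a ∈ ρ → Δ a = none)

/-- Checked large-step semantics for expressions: `σ₁, ρ₁, e ⇓ σ₂, ρ₂, v`. -/
inductive EBig : Env → Set ℕ → Exp → Env → Set ℕ → Val → Prop where
  | val : ∀ σ ρ v, EBig σ ρ (.val v) σ ρ v
  | bop : ∀ σ ρ σ₂ ρ₂ σ₃ ρ₃ op e₁ e₂ v₁ v₂,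
      EBig σ ρ e₁ σ₂ ρ₂ v₁ → EBig σ₂ ρ₂ e₂ σ₃ ρ₃ v₂ →
      EBig σ ρ (.bop op e₁ e₂) σ₃ ρ₃ (.bop op v₁ v₂)
  | var : ∀ σ ρ x v, σ.vars x = some v → EBig σ ρ (.var x) σ ρ v
  | read : ∀ σ ρ σ₂ ρ₂ a e n M,
      EBig σ ρ e σ₂ ρ₂ (.num n) → a ∉ ρ₂ → σ₂.mems a = some M →
      EBig σ ρ (.read a e) σ₂ (ρ₂ ∪ {a}) (M n)

/-- Checked large-step semantics for commands: `σ₁, ρ₁, c ⇓ σ₂, ρ₂`.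
Unordered composition threads `ρ`; ordered composition runs each command in
the same initial `ρ` and unions the resulting accessed sets. -/
inductive CBig : Env → Set ℕ → Cmd → Env → Set ℕ → Prop where
  | exp : ∀ σ ρ σ₂ ρ₂ e v, EBig σ ρ e σ₂ ρ₂ v → CBig σ ρ (.exp e) σ₂ ρ₂
  | letv : ∀ σ ρ σ₂ ρ₂ x e v, EBig σ ρ e σ₂ ρ₂ v →
      CBig σ ρ (.letv x e) (σ₂.updVar x v) ρ₂
  | seq : ∀ σ ρ σ₂ ρ₂ σ₃ ρ₃ c₁ c₂,
      CBig σ ρ c₁ σ₂ ρ₂ → CBig σ₂ ρ c₂ σ₃ ρ₃ →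
      CBig σ ρ (.seq c₁ c₂) σ₃ (ρ₂ ∪ ρ₃)
  | interseq : ∀ σ ρ σ₂ ρ₂ σ₃ ρ₀ ρ₀' c₁ c₂,
      CBig σ ρ c₁ σ₂ ρ₂ → CBig σ₂ ρ₀ c₂ σ₃ ρ₀' →
      CBig σ ρ (.interseq c₁ ρ₀ c₂) σ₃ (ρ₂ ∪ ρ₀')
  | par : ∀ σ ρ σ₂ ρ₂ σ₃ ρ₃ c₁ c₂,
      CBig σ ρ c₁ σ₂ ρ₂ → CBig σ₂ ρ₂ c₂ σ₃ ρ₃ →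
      CBig σ ρ (.par c₁ c₂) σ₃ ρ₃
  | iteT : ∀ σ ρ σ₂ ρ₂ x c₁ c₂, σ.vars x = some (.bool true) →
      CBig σ ρ c₁ σ₂ ρ₂ → CBig σ ρ (.ite x c₁ c₂) σ₂ ρ₂
  | iteF : ∀ σ ρ σ₂ ρ₂ x c₁ c₂, σ.vars x = some (.bool false) →
      CBig σ ρ c₂ σ₂ ρ₂ → CBig σ ρ (.ite x c₁ c₂) σ₂ ρ₂
  | whileF : ∀ σ ρ x c, σ.vars x = some (.bool false) →
      CBig σ ρ (.while x c) σ ρ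
  | whileT : ∀ σ ρ σ₂ ρ₂ σ₃ ρ₃ x c, σ.vars x = some (.bool true) →
      CBig σ ρ c σ₂ ρ₂ → CBig σ₂ ρ (.while x c) σ₃ ρ₃ →
      CBig σ ρ (.while x c) σ₃ (ρ₂ ∪ ρ₃)
  | assign : ∀ σ ρ σ₂ ρ₂ x e v, EBig σ ρ e σ₂ ρ₂ v →
      CBig σ ρ (.assign x e) (σ₂.updVar x v) ρ₂
  | write : ∀ σ ρ σ₂ ρ₂ σ₃ ρ₃ a e₁ e₂ n v M,
      EBig σ ρ e₁ σ₂ ρ₂ (.num n) → EBig σ₂ ρ₂ e₂ σ₃ ρ₃ v →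
      a ∉ ρ₃ → σ₃.mems a = some M →
      CBig σ ρ (.write a e₁ e₂) (σ₃.updMem a n v) (ρ₃ ∪ {a})
  | skip : ∀ σ ρ, CBig σ ρ .skip σ ρ

theorem estep_ebig {σ ρ e σ' ρ' e'} (h : EStep σ ρ e σ' ρ' e') :
    ∀ {σ₂ ρ₂ v}, EBig σ' ρ' e' σ₂ ρ₂ v → EBig σ ρ e σ₂ ρ₂ v := by
  induction h with
  | bop1 _ _ _ _ _ _ _ ih =>
    intro _ _ _ hb; cases hb with
    | bop _ _ _ _ _ _ _ _ _ _ _ h1 h2 => exact .bop _ _ _ _ _ _ _ _ _ _ _ (ih h1) h2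
  | bop2 _ _ _ _ _ _ _ ih =>
    intro _ _ _ hb; cases hb with
    | bop _ _ _ _ _ _ _ _ _ _ _ h1 h2 =>
      cases h1; exact .bop _ _ _ _ _ _ _ _ _ _ _ (.val _ _ _) (ih h2)
  | bop3 =>
    intro _ _ _ hb; cases hb
    exact .bop _ _ _ _ _ _ _ _ _ _ _ (.val _ _ _) (.val _ _ _)
  | var _ _ hx => intro _ _ _ hb; cases hb; exact .var _ _ _ _ hx
  | read1 _ _ _ _ _ _ ih =>
    intro _ _ _ hb; cases hb with
    | read _ _ _ _ _ _ _ _ h1 h2 h3 => exact .read _ _ _ _ _ _ _ _ (ih h1) h2 h3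
  | read2 _ _ _ h1 h2 =>
    intro _ _ _ hb; cases hb; exact .read _ _ _ _ _ _ _ _ (.val _ _ _) h1 h2

theorem cstep_cbig {σ ρ c σ' ρ' c'} (h : CStep σ ρ c σ' ρ' c') :
    ∀ {σ₂ ρ₂}, CBig σ' ρ' c' σ₂ ρ₂ → CBig σ ρ c σ₂ ρ₂ := by
  induction h with
  | exp1 _ _ _ _ _ he =>
    intro _ _ hb; cases hb with
    | exp _ _ _ _ _ _ h => exact .exp _ _ _ _ _ _ (estep_ebig he h)
  | exp2 => intro _ _ hb; cases hb; exact .exp _ _ _ _ _ _ (.val _ _ _)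
  | let1 _ _ _ _ _ _ he =>
    intro _ _ hb; cases hb with
    | letv _ _ _ _ _ _ _ h => exact .letv _ _ _ _ _ _ _ (estep_ebig he h)
  | let2 => intro _ _ hb; cases hb; exact .letv _ _ _ _ _ _ _ (.val _ _ _)
  | seq =>
    intro _ _ hb; cases hb with
    | interseq _ _ _ _ _ _ _ _ _ h1 h2 => exact .seq _ _ _ _ _ _ _ _ h1 h2
  | interseq1 _ _ _ _ _ _ _ _ ih =>
    intro _ _ hb; cases hb with
    | interseq _ _ _ _ _ _ _ _ _ h1 h2 => exact .interseq _ _ _ _ _ _ _ _ _ (ih h1) h2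
  | interseq2 _ _ _ _ _ _ _ ih =>
    intro _ _ hb; cases hb with
    | interseq _ _ _ _ _ _ _ _ _ h1 h2 =>
      cases h1; exact .interseq _ _ _ _ _ _ _ _ _ (.skip _ _) (ih h2)
  | interseq3 =>
    intro _ _ hb; cases hb; exact .interseq _ _ _ _ _ _ _ _ _ (.skip _ _) (.skip _ _)
  | par1 _ _ _ _ _ _ _ ih =>
    intro _ _ hb; cases hb with
    | par _ _ _ _ _ _ _ _ h1 h2 => exact .par _ _ _ _ _ _ _ _ (ih h1) h2
  | par2 => intro _ _ hb; exact .par _ _ _ _ _ _ _ _ (.skip _ _) hb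
  | iteT _ _ _ _ hx => intro _ _ hb; exact .iteT _ _ _ _ _ _ _ hx hb
  | iteF _ _ _ _ hx => intro _ _ hb; exact .iteF _ _ _ _ _ _ _ hx hb
  | whileStep =>
    intro _ _ hb; cases hb with
    | iteT _ _ _ _ _ _ _ hx h =>
      cases h with
      | seq _ _ _ _ _ _ _ _ h1 h2 => exact .whileT _ _ _ _ _ _ _ _ hx h1 h2
    | iteF _ _ _ _ _ _ _ hx h => cases h; exact .whileF _ _ _ _ hx
  | assign1 _ _ _ _ _ _ he =>
    intro _ _ hb; cases hb with
    | assign _ _ _ _ _ _ _ h => exact .assign _ _ _ _ _ _ _ (estep_ebig he h)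
  | assign2 => intro _ _ hb; cases hb; exact .assign _ _ _ _ _ _ _ (.val _ _ _)
  | write1 _ _ _ _ _ _ _ he =>
    intro _ _ hb; cases hb with
    | write _ _ _ _ _ _ _ _ _ _ _ _ h1 h2 h3 h4 =>
      exact .write _ _ _ _ _ _ _ _ _ _ _ _ (estep_ebig he h1) h2 h3 h4
  | write2 _ _ _ _ _ _ _ he =>
    intro _ _ hb; cases hb with
    | write _ _ _ _ _ _ _ _ _ _ _ _ h1 h2 h3 h4 =>
      cases h1
      exact .write _ _ _ _ _ _ _ _ _ _ _ _ (.val _ _ _) (estep_ebig he h2) h3 h4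
  | write3 _ _ _ _ _ h1 h2 =>
    intro _ _ hb; cases hb
    exact .write _ _ _ _ _ _ _ _ _ _ _ _ (.val _ _ _) (.val _ _ _) h1 h2

theorem rtg_lift {α β : Type} {p : α → α → Prop} {q : β → β → Prop} (f : α → β)
    (hf : ∀ a b, p a b → q (f a) (f b)) {a b : α} (h : Relation.ReflTransGen p a b) :
    Relation.ReflTransGen q (f a) (f b) := by
  induction h with
  | refl => exact .refl
  | tail _ h ih => exact ih.tail (hf _ _ h)

theorem shead {σ ρ c σ' ρ' c'} {K : Config} (h : CStep σ ρ c σ' ρ' c')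
    (h2 : Relation.ReflTransGen Step (σ', ρ', c') K) :
    Relation.ReflTransGen Step (σ, ρ, c) K :=
  Relation.ReflTransGen.head (b := (σ', ρ', c')) h h2

/-- The expression step relation on configurations. -/
def EStepC (K K' : Env × Set ℕ × Exp) : Prop :=
  EStep K.1 K.2.1 K.2.2 K'.1 K'.2.1 K'.2.2

theorem ebig_steps {σ ρ e σ' ρ' v} (h : EBig σ ρ e σ' ρ' v) :
    Relation.ReflTransGen EStepC (σ, ρ, e) (σ', ρ', .val v) := by
  induction h with
  | val => exact .refl
  | bop σ ρ σ₂ ρ₂ σ₃ ρ₃ op e₁ e₂ v₁ v₂ _ _ ih1 ih2 =>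
    have a := rtg_lift (q := EStepC)
      (fun K : Env × Set ℕ × Exp => (K.1, K.2.1, Exp.bop op K.2.2 e₂))
      (fun _ _ h => EStep.bop1 _ _ _ _ _ _ _ _ h) ih1
    have b := rtg_lift (q := EStepC)
      (fun K : Env × Set ℕ × Exp => (K.1, K.2.1, Exp.bop op (.val v₁) K.2.2))
      (fun _ _ h => EStep.bop2 _ _ _ _ _ _ _ _ h) ih2
    exact (a.trans b).tail (EStep.bop3 _ _ _ _ _)
  | var _ _ _ _ hx => exact .single (EStep.var _ _ _ _ hx)
  | read σ ρ σ₂ ρ₂ a e n M _ h1 h2 ih =>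
    have b := rtg_lift (q := EStepC)
      (fun K : Env × Set ℕ × Exp => (K.1, K.2.1, Exp.read a K.2.2))
      (fun _ _ h => EStep.read1 _ _ _ _ _ _ _ h) ih
    exact b.tail (EStep.read2 _ _ _ _ _ h1 h2)

theorem interseq_steps {σ ρ σ₂ ρ₂ σ₃ ρ₀ ρ₃ c₁ c₂}
    (h1 : Relation.ReflTransGen Step (σ, ρ, c₁) (σ₂, ρ₂, Cmd.skip))
    (h2 : Relation.ReflTransGen Step (σ₂, ρ₀, c₂) (σ₃, ρ₃, Cmd.skip)) :
    Relation.ReflTransGen Step (σ, ρ, Cmd.interseq c₁ ρ₀ c₂) (σ₃, ρ₂ ∪ ρ₃, Cmd.skip) := by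
  have a := rtg_lift (q := Step)
    (fun K : Config => (K.1, K.2.1, Cmd.interseq K.2.2 ρ₀ c₂))
    (fun _ _ h => CStep.interseq1 _ _ _ _ _ _ _ _ h) h1
  have b := rtg_lift (q := Step)
    (fun K : Config => (K.1, ρ₂, Cmd.interseq .skip K.2.1 K.2.2))
    (fun _ _ h => CStep.interseq2 _ _ _ _ _ _ _ h) h2
  exact (a.trans b).tail (CStep.interseq3 _ _ _)

theorem cbig_steps {σ ρ c σ' ρ'} (h : CBig σ ρ c σ' ρ') :
    Relation.ReflTransGen Step (σ, ρ, c) (σ', ρ', Cmd.skip) := by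
  induction h with
  | exp σ ρ σ₂ ρ₂ e v h =>
    exact (rtg_lift (q := Step)
      (fun K : Env × Set ℕ × Exp => (K.1, K.2.1, Cmd.exp K.2.2))
      (fun _ _ h => CStep.exp1 _ _ _ _ _ _ h) (ebig_steps h)).tail (CStep.exp2 _ _ _)
  | letv σ ρ σ₂ ρ₂ x e v h =>
    exact (rtg_lift (q := Step)
      (fun K : Env × Set ℕ × Exp => (K.1, K.2.1, Cmd.letv x K.2.2))
      (fun _ _ h => CStep.let1 _ _ _ _ _ _ _ h) (ebig_steps h)).tail (CStep.let2 _ _ _ _)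
  | seq σ ρ σ₂ ρ₂ σ₃ ρ₃ c₁ c₂ _ _ ih1 ih2 =>
    exact shead (CStep.seq _ _ _ _) (interseq_steps ih1 ih2)
  | interseq _ _ _ _ _ _ _ _ _ _ _ ih1 ih2 => exact interseq_steps ih1 ih2
  | par σ ρ σ₂ ρ₂ σ₃ ρ₃ c₁ c₂ _ _ ih1 ih2 =>
    exact (rtg_lift (q := Step)
      (fun K : Config => (K.1, K.2.1, Cmd.par K.2.2 c₂))
      (fun _ _ h => CStep.par1 _ _ _ _ _ _ _ h) ih1).trans (shead (CStep.par2 _ _ _) ih2)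
  | iteT _ _ _ _ _ _ _ hx _ ih => exact shead (CStep.iteT _ _ _ _ _ hx) ih
  | iteF _ _ _ _ _ _ _ hx _ ih => exact shead (CStep.iteF _ _ _ _ _ hx) ih
  | whileF _ _ _ _ hx =>
    exact shead (CStep.whileStep _ _ _ _) (shead (CStep.iteF _ _ _ _ _ hx) .refl)
  | whileT _ _ _ _ _ _ _ _ hx _ _ ih1 ih2 =>
    exact shead (CStep.whileStep _ _ _ _) (shead (CStep.iteT _ _ _ _ _ hx)
      (shead (CStep.seq _ _ _ _) (interseq_steps ih1 ih2)))
  | assign σ ρ σ₂ ρ₂ x e v h =>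
    exact (rtg_lift (q := Step)
      (fun K : Env × Set ℕ × Exp => (K.1, K.2.1, Cmd.assign x K.2.2))
      (fun _ _ h => CStep.assign1 _ _ _ _ _ _ _ h) (ebig_steps h)).tail
      (CStep.assign2 _ _ _ _)
  | write σ ρ σ₂ ρ₂ σ₃ ρ₃ a e₁ e₂ n v M h1 h2 h3 h4 =>
    have p := rtg_lift (q := Step)
      (fun K : Env × Set ℕ × Exp => (K.1, K.2.1, Cmd.write a K.2.2 e₂))
      (fun _ _ h => CStep.write1 _ _ _ _ _ _ _ _ h) (ebig_steps h1)
    have q := rtg_lift (q := Step)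
      (fun K : Env × Set ℕ × Exp => (K.1, K.2.1, Cmd.write a (.val (.num n)) K.2.2))
      (fun _ _ h => CStep.write2 _ _ _ _ _ _ _ _ h) (ebig_steps h2)
    exact (p.trans q).tail (CStep.write3 _ _ _ _ _ _ h3 h4)
  | skip => exact .refl

theorem steps_cbig {K : Config} {σ₂ ρ₂}
    (h : Relation.ReflTransGen Step K (σ₂, ρ₂, Cmd.skip)) :
    CBig K.1 K.2.1 K.2.2 σ₂ ρ₂ := by
  induction h using Relation.ReflTransGen.head_induction_on with
  | refl => exact .skip _ _
  | head h _ ih => exact cstep_cbig h ih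

/-- **Agreement of the small-step and big-step checked semantics.**  For any
command `c`, the iterated checked small-step semantics takes `(σ₁, ρ₁, c)` to
the terminal configuration `(σ₂, ρ₂, skip)` if and only if the checked
large-step semantics derives `σ₁, ρ₁, c ⇓ σ₂, ρ₂`. -/
theorem filament_smallstep_bigstep_agree (c : Cmd) (σ₁ : Env) (ρ₁ : Set ℕ)
    (σ₂ : Env) (ρ₂ : Set ℕ) :
    Relation.ReflTransGen Step (σ₁, ρ₁, c) (σ₂, ρ₂, Cmd.skip) ↔
      CBig σ₁ ρ₁ c σ₂ ρ₂ := by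
  exact ⟨fun h => steps_cbig h, cbig_steps⟩
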